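/- arXiv:2007.09193 — 11 statements merged into one kernel-verified Lean document; each statement's English description precedes it below -/
import Mathlib

section
/- Let (d, x) be a feasible solution to (MP1). Define u_{jk} = x_{jk} d_j for all j, k, and d_0 = 1 − ∑_{j=1}^J d_j. Then (d, d_0, u) is a feasible solution to (MCOP1), and its objective value in (MCOP1) equals the objective value of (d, x) in (MP1). -/
open Finset

/-- Objective of problem (MP1). -/
noncomputable def MP1Obj {J K : ℕ} (φ : Fin J → Fin K → ℝ) (ψ : Fin J → ℝ)
    (d : Fin J → ℝ) (x : Fin J → Fin K → ℝ) : ℝ :=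
  ∑ j, (∑ k, φ j k * x j k - ψ j) * d j

/-- Feasibility for problem (MP1). -/
def MP1Feasible {J K : ℕ} (xl xu : Fin J → Fin K → ℝ)
    (d : Fin J → ℝ) (x : Fin J → Fin K → ℝ) : Prop :=
  (∀ j, d j = Real.exp (-(∑ k, x j k)) / (1 + ∑ j', Real.exp (-(∑ k, x j' k)))) ∧
  (∀ j k, xl j k ≤ x j k ∧ x j k ≤ xu j k)

/-- Optimality for problem (MP1). -/
def MP1Optimal {J K : ℕ} (φ : Fin J → Fin K → ℝ) (ψ : Fin J → ℝ)
    (xl xu : Fin J → Fin K → ℝ) (d : Fin J → ℝ) (x : Fin J → Fin K → ℝ) : Prop :=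
  MP1Feasible xl xu d x ∧
  ∀ d' x', MP1Feasible xl xu d' x' → MP1Obj φ ψ d' x' ≤ MP1Obj φ ψ d x

/-- Objective of problem (MCOP1). -/
noncomputable def MCOP1Obj {J K : ℕ} (φ : Fin J → Fin K → ℝ) (ψ : Fin J → ℝ)
    (d : Fin J → ℝ) (u : Fin J → Fin K → ℝ) : ℝ :=
  ∑ j, (∑ k, φ j k * u j k - ψ j * d j)

/-- Feasibility for problem (MCOP1). -/
def MCOP1Feasible {J K : ℕ} (xl xu : Fin J → Fin K → ℝ)
    (d : Fin J → ℝ) (d0 : ℝ) (u : Fin J → Fin K → ℝ) : Prop :=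
  (∀ j, d j * Real.log (d j / d0) ≤ -(∑ k, u j k)) ∧
  (∀ j, d0 * Real.log (d0 / d j) ≤ d0 * ∑ k, xu j k) ∧
  (∀ j k, xl j k * d j ≤ u j k ∧ u j k ≤ xu j k * d j) ∧
  (d0 + ∑ j, d j = 1) ∧
  (∀ j, 0 < d j) ∧ 0 < d0

/-- Optimality for problem (MCOP1). -/
def MCOP1Optimal {J K : ℕ} (φ : Fin J → Fin K → ℝ) (ψ : Fin J → ℝ)
    (xl xu : Fin J → Fin K → ℝ)
    (d : Fin J → ℝ) (d0 : ℝ) (u : Fin J → Fin K → ℝ) : Prop :=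
  MCOP1Feasible xl xu d d0 u ∧
  ∀ d' d0' u', MCOP1Feasible xl xu d' d0' u' → MCOP1Obj φ ψ d' u' ≤ MCOP1Obj φ ψ d u

/-- a feasible solution of (MP1) transforms into a feasible solution
of (MCOP1) with the same objective value. -/
theorem mp1_to_mcop1 (J K : ℕ) (hJ : 0 < J) (hK : 0 < K)
    (φ : Fin J → Fin K → ℝ) (hφ : ∀ j k, 0 < φ j k) (ψ : Fin J → ℝ)
    (xl xu : Fin J → Fin K → ℝ) (hbounds : ∀ j k, xl j k ≤ xu j k)
    (d : Fin J → ℝ) (x : Fin J → Fin K → ℝ)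
    (hfeas : MP1Feasible xl xu d x)
    (u : Fin J → Fin K → ℝ) (hu : ∀ j k, u j k = x j k * d j)
    (d0 : ℝ) (hd0 : d0 = 1 - ∑ j, d j) :
    MCOP1Feasible xl xu d d0 u ∧ MCOP1Obj φ ψ d u = MP1Obj φ ψ d x := by
  obtain ⟨hd, hx⟩ := hfeas
  have hS : 0 < 1 + ∑ j, Real.exp (-(∑ k, x j k)) := by positivity
  have hd0_eq : d0 = 1 / (1 + ∑ j, Real.exp (-(∑ k, x j k))) := by
    rw [hd0, Finset.sum_congr rfl fun j _ => hd j, ← Finset.sum_div]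
    field_simp
    ring
  have hd0_pos : 0 < d0 := by rw [hd0_eq]; positivity
  have hd_mul : ∀ j, d j = Real.exp (-(∑ k, x j k)) * d0 := fun j => by
    rw [hd0_eq, hd j, mul_one_div]
  have hd_pos : ∀ j, 0 < d j := fun j => by rw [hd_mul j]; positivity
  have hlog : ∀ j, Real.log (d j / d0) = -∑ k, x j k := fun j => by
    rw [hd_mul j, mul_div_cancel_right₀ _ hd0_pos.ne', Real.log_exp]
  refine ⟨⟨fun j => ?_, fun j => ?_, fun j k => ?_, by rw [hd0]; ring, hd_pos, hd0_pos⟩, ?_⟩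
  · simp only [hlog, hu, ← Finset.sum_mul]
    exact le_of_eq (by ring)
  · rw [← inv_div, Real.log_inv, hlog, neg_neg]
    gcongr with k
    exact (hx j k).2
  · rw [hu]
    exact ⟨mul_le_mul_of_nonneg_right (hx j k).1 (hd_pos j).le,
      mul_le_mul_of_nonneg_right (hx j k).2 (hd_pos j).le⟩
  · simp only [MCOP1Obj, MP1Obj, hu, sub_mul, Finset.sum_mul, mul_assoc]
end

section
/- Let (d, d_0, u) be a feasible solution to (MCOP1) such that d_j ln(d_j/d_0) = −∑_{k=1}^K u_{jk} for every j = 1,…,J. Define x_{jk} = u_{jk}/d_j for all j, k. Then (d, x) is a feasible solution to (MP1), and its objective value in (MP1) equals the objective value of (d, d_0, u) in (MCOP1). -/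
open Finset

/-- a feasible solution of (MCOP1) at which the first family of
constraints is tight transforms into a feasible solution of (MP1) with the
same objective value. -/
theorem mcop1_to_mp1 (J K : ℕ) (hJ : 0 < J) (hK : 0 < K)
    (φ : Fin J → Fin K → ℝ) (hφ : ∀ j k, 0 < φ j k) (ψ : Fin J → ℝ)
    (xl xu : Fin J → Fin K → ℝ) (hbounds : ∀ j k, xl j k ≤ xu j k)
    (d : Fin J → ℝ) (d0 : ℝ) (u : Fin J → Fin K → ℝ)
    (hfeas : MCOP1Feasible xl xu d d0 u)
    (htight : ∀ j, d j * Real.log (d j / d0) = -(∑ k, u j k))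
    (x : Fin J → Fin K → ℝ) (hx : ∀ j k, x j k = u j k / d j) :
    MP1Feasible xl xu d x ∧ MP1Obj φ ψ d x = MCOP1Obj φ ψ d u := by
  obtain ⟨-, -, hu, hsum, hd, hd0⟩ := hfeas
  have hexp : ∀ j, Real.exp (-(∑ k, x j k)) = d j / d0 := by
    intro j
    have hlog : -(∑ k, x j k) = Real.log (d j / d0) := by
      simp only [hx]
      rw [← Finset.sum_div, ← neg_div, ← htight j, mul_div_cancel_left₀ _ (hd j).ne']
    rw [hlog, Real.exp_log (div_pos (hd j) hd0)]
  have hden : 1 + ∑ j, d j / d0 = 1 / d0 := by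
    rw [← Finset.sum_div, one_add_div hd0.ne', hsum]
  refine ⟨⟨fun j => ?_, fun j k => ?_⟩, ?_⟩
  · simp only [hexp]
    rw [hden, div_div_div_cancel_right₀ hd0.ne', div_one]
  · rw [hx, le_div_iff₀ (hd j), div_le_iff₀ (hd j)]
    exact hu j k
  · unfold MP1Obj MCOP1Obj
    refine Finset.sum_congr rfl fun j _ => ?_
    rw [sub_mul, Finset.sum_mul]
    congr 1
    refine Finset.sum_congr rfl fun k _ => ?_
    rw [hx, mul_assoc, div_mul_cancel₀ _ (hd j).ne']
end

section
/- Let (d*, d_0*, u*) be an optimal solution to (MCOP1). Then the first family of constraints holds with equality: d_j* ln(d_j*/d_0*) = −∑_{k=1}^K u_{jk}* for every j = 1,…,J. -/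
open Finset

/-- If the first constraint of index `j` is slack, then some `u j k` lies strictly below its upper
bound. -/
theorem MCOP1Feasible.exists_lt_of_slack {J K : ℕ} {xl xu : Fin J → Fin K → ℝ}
    {d : Fin J → ℝ} {d0 : ℝ} {u : Fin J → Fin K → ℝ} (h : MCOP1Feasible xl xu d d0 u)
    {j : Fin J} (hj : d j * Real.log (d j / d0) < -(∑ k, u j k)) :
    ∃ k, u j k < xu j k * d j := by
  obtain ⟨-, h2, -, -, hd, hd0⟩ := h
  by_contra! hu
  have hlog : Real.log (d0 / d j) ≤ ∑ k, xu j k := le_of_mul_le_mul_left (h2 j) hd0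
  have hsum : (∑ k, xu j k) * d j ≤ ∑ k, u j k := by
    rw [Finset.sum_mul]
    exact Finset.sum_le_sum fun k _ => hu k
  have hinv : Real.log (d j / d0) = -Real.log (d0 / d j) := by
    rw [← Real.log_inv, inv_div]
  rw [hinv] at hj
  nlinarith [mul_le_mul_of_nonneg_right hlog (hd j).le]

/-- Increasing a single entry of `u` by an amount covered by the slack of the two constraints
bounding it from above preserves feasibility. -/
theorem MCOP1Feasible.add_single {J K : ℕ} {xl xu : Fin J → Fin K → ℝ}
    {d : Fin J → ℝ} {d0 : ℝ} {u : Fin J → Fin K → ℝ} (h : MCOP1Feasible xl xu d d0 u)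
    {j : Fin J} {k : Fin K} {ε : ℝ} (hε : 0 ≤ ε)
    (hlog : ε ≤ -(∑ k, u j k) - d j * Real.log (d j / d0))
    (hbound : ε ≤ xu j k * d j - u j k) :
    MCOP1Feasible xl xu d d0 (fun a b => u a b + if a = j ∧ b = k then ε else 0) := by
  obtain ⟨h1, h2, h3, h4⟩ := h
  refine ⟨fun a => ?_, h2, fun a b => ?_, h4⟩
  · by_cases ha : a = j
    · subst ha
      simp only [true_and, Finset.sum_add_distrib, Finset.sum_ite_eq', Finset.mem_univ, if_true]
      linarith
    · simpa [ha] using h1 a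
  · obtain ⟨hl, hu⟩ := h3 a b
    dsimp only
    split_ifs with hab
    · obtain ⟨rfl, rfl⟩ := hab
      constructor <;> linarith
    · simpa using And.intro hl hu

theorem MCOP1Obj_add_single {J K : ℕ} (φ : Fin J → Fin K → ℝ) (ψ d : Fin J → ℝ)
    (u : Fin J → Fin K → ℝ) (j : Fin J) (k : Fin K) (ε : ℝ) :
    MCOP1Obj φ ψ d (fun a b => u a b + if a = j ∧ b = k then ε else 0) =
      MCOP1Obj φ ψ d u + φ j k * ε := by
  have hsingle : ∑ a, ∑ b, φ a b * (if a = j ∧ b = k then ε else 0) = φ j k * ε := by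
    rw [Finset.sum_eq_single j (by simp +contextual) (by simp)]
    simp
  simp only [MCOP1Obj, mul_add, Finset.sum_add_distrib, Finset.sum_sub_distrib, hsingle]
  ring

/-- at an optimal solution of (MCOP1), the first family of
constraints holds with equality. -/
theorem mcop1_tight_at_optimum (J K : ℕ) (hJ : 0 < J) (hK : 0 < K)
    (φ : Fin J → Fin K → ℝ) (hφ : ∀ j k, 0 < φ j k) (ψ : Fin J → ℝ)
    (xl xu : Fin J → Fin K → ℝ) (hbounds : ∀ j k, xl j k ≤ xu j k)
    (d : Fin J → ℝ) (d0 : ℝ) (u : Fin J → Fin K → ℝ)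
    (hopt : MCOP1Optimal φ ψ xl xu d d0 u) :
    ∀ j, d j * Real.log (d j / d0) = -(∑ k, u j k) := by
  intro j
  obtain ⟨hfeas, hmax⟩ := hopt
  by_contra hne
  have hslack := lt_of_le_of_ne (hfeas.1 j) hne
  obtain ⟨k, hk⟩ := hfeas.exists_lt_of_slack hslack
  obtain ⟨ε, hε, hε'⟩ := exists_between (lt_min (sub_pos.2 hslack) (sub_pos.2 hk))
  obtain ⟨hlog, hbound⟩ := lt_min_iff.1 hε'
  have hle := hmax _ _ _ (hfeas.add_single hε.le hlog.le hbound.le)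
  rw [MCOP1Obj_add_single] at hle
  linarith [mul_pos (hφ j k) hε]
end

section
/- Suppose (d*, d_0*, u*) is an optimal solution to (MCOP1). Define x_{jk}* = u_{jk}*/d_j* for all j = 1,…,J and k = 1,…,K. Then (d*, x*) is an optimal solution to (MP1). -/
open Finset

theorem log_constraint_tight_of_mcop1Optimal {J K : ℕ} {φ : Fin J → Fin K → ℝ}
    (hφ : ∀ j k, 0 < φ j k) {ψ : Fin J → ℝ} {xl xu : Fin J → Fin K → ℝ}
    {d : Fin J → ℝ} {d0 : ℝ} {u : Fin J → Fin K → ℝ}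
    (hopt : MCOP1Optimal φ ψ xl xu d d0 u) (j : Fin J) :
    d j * Real.log (d j / d0) = -(∑ k, u j k) := by
  obtain ⟨⟨h1, h2, h3, h4, h5, h6⟩, hmax⟩ := hopt
  refine (h1 j).eq_of_not_lt fun hlt => ?_
  have hlog : Real.log (d0 / d j) = -Real.log (d j / d0) := by
    rw [← Real.log_inv, inv_div]
  have hcap : -Real.log (d j / d0) ≤ ∑ k, xu j k := by
    rw [← hlog]
    exact le_of_mul_le_mul_left (h2 j) h6
  have hsum : ∑ k, u j k < ∑ k, xu j k * d j := by
    rw [← Finset.sum_mul]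
    nlinarith [mul_le_mul_of_nonneg_left hcap (h5 j).le]
  obtain ⟨k, -, hk⟩ := Finset.exists_lt_of_sum_lt hsum
  obtain ⟨ε, hε, hε'⟩ : ∃ ε, 0 < ε ∧
      ε ≤ min (-(∑ k, u j k) - d j * Real.log (d j / d0)) (xu j k * d j - u j k) :=
    ⟨_, lt_min (by linarith) (by linarith), le_rfl⟩
  obtain ⟨hgap, hroom⟩ := le_min_iff.mp hε'
  set v : Fin J → Fin K → ℝ := fun i l => u i l + if i = j ∧ l = k then ε else 0 with hv
  have hfeas : MCOP1Feasible xl xu d d0 v := by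
    refine ⟨fun i => ?_, h2, fun i l => ?_, h4, h5, h6⟩
    · by_cases hi : i = j
      · subst hi
        simp only [hv, true_and, Finset.sum_add_distrib, Finset.sum_ite_eq',
          Finset.mem_univ, if_true]
        linarith
      · simpa [hv, hi] using h1 i
    · by_cases hil : i = j ∧ l = k
      · obtain ⟨rfl, rfl⟩ := hil
        simp only [hv, and_self, if_true]
        constructor <;> linarith [(h3 i l).1]
      · simpa [hv, hil] using h3 i l
  have hobj : MCOP1Obj φ ψ d u < MCOP1Obj φ ψ d v := by
    have hle : ∀ i l, φ i l * u i l ≤ φ i l * v i l := fun i l => by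
      refine mul_le_mul_of_nonneg_left ?_ (hφ i l).le
      simp only [hv]
      split_ifs <;> linarith
    refine Finset.sum_lt_sum
      (fun i _ => sub_le_sub_right (Finset.sum_le_sum fun l _ => hle i l) _)
      ⟨j, Finset.mem_univ j, sub_lt_sub_right (Finset.sum_lt_sum (fun l _ => hle j l)
        ⟨k, Finset.mem_univ k, mul_lt_mul_of_pos_left ?_ (hφ j k)⟩) _⟩
    simpa [hv] using hε
  exact (hmax d d0 v hfeas).not_gt hobj

theorem MCOP1Obj_mul_eq_MP1Obj {J K : ℕ} (φ : Fin J → Fin K → ℝ) (ψ d : Fin J → ℝ)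
    (x : Fin J → Fin K → ℝ) :
    MCOP1Obj φ ψ d (fun j k => x j k * d j) = MP1Obj φ ψ d x := by
  simp only [MCOP1Obj, MP1Obj, sub_mul, Finset.sum_mul, mul_assoc]

theorem MP1Feasible.mcop1Feasible {J K : ℕ} {xl xu : Fin J → Fin K → ℝ}
    {d : Fin J → ℝ} {x : Fin J → Fin K → ℝ} (h : MP1Feasible xl xu d x) :
    MCOP1Feasible xl xu d (1 + ∑ j, Real.exp (-(∑ k, x j k)))⁻¹
      (fun j k => x j k * d j) := by
  obtain ⟨hd, hb⟩ := h
  set S := 1 + ∑ j, Real.exp (-(∑ k, x j k)) with hS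
  have hSpos : 0 < S := by positivity
  have hpos : ∀ j, 0 < d j := fun j => by
    rw [hd j]
    positivity
  have hratio : ∀ j, d j / S⁻¹ = Real.exp (-(∑ k, x j k)) := fun j => by
    rw [hd j]
    field_simp
  refine ⟨fun j => ?_, fun j => ?_, fun j k => ?_, ?_, hpos, inv_pos.mpr hSpos⟩
  · rw [hratio, Real.log_exp, ← Finset.sum_mul]
    linarith
  · rw [← inv_div, hratio, Real.log_inv, Real.log_exp, neg_neg]
    exact mul_le_mul_of_nonneg_left (Finset.sum_le_sum fun k _ => (hb j k).2)
      (inv_pos.mpr hSpos).le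
  · exact ⟨mul_le_mul_of_nonneg_right (hb j k).1 (hpos j).le,
      mul_le_mul_of_nonneg_right (hb j k).2 (hpos j).le⟩
  · simp only [hd, ← Finset.sum_div]
    rw [inv_eq_one_div, ← add_div, div_self hSpos.ne']

/-- an optimal solution of (MCOP1) transforms into an optimal
solution of (MP1) via `x_{jk} = u_{jk} / d_j`. -/
theorem mcop1_optimal_to_mp1_optimal (J K : ℕ) (hJ : 0 < J) (hK : 0 < K)
    (φ : Fin J → Fin K → ℝ) (hφ : ∀ j k, 0 < φ j k) (ψ : Fin J → ℝ)
    (xl xu : Fin J → Fin K → ℝ) (hbounds : ∀ j k, xl j k ≤ xu j k)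
    (d : Fin J → ℝ) (d0 : ℝ) (u : Fin J → Fin K → ℝ)
    (hopt : MCOP1Optimal φ ψ xl xu d d0 u)
    (x : Fin J → Fin K → ℝ) (hx : ∀ j k, x j k = u j k / d j) :
    MP1Optimal φ ψ xl xu d x := by
  have htight := log_constraint_tight_of_mcop1Optimal hφ hopt
  obtain ⟨⟨-, -, h3, h4, h5, h6⟩, hmax⟩ := hopt
  have hu : u = fun j k => x j k * d j := by
    funext j k
    rw [hx, div_mul_cancel₀ _ (h5 j).ne']
  have hexp : ∀ j, d j = d0 * Real.exp (-(∑ k, x j k)) := fun j => by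
    have hlog : Real.log (d j / d0) = -(∑ k, x j k) := by
      refine mul_left_cancel₀ (h5 j).ne' ((htight j).trans ?_)
      simp only [hu, ← Finset.sum_mul]
      ring
    rw [← hlog, Real.exp_log (div_pos (h5 j) h6), mul_div_cancel₀ _ h6.ne']
  have htotal : d0 * (1 + ∑ j, Real.exp (-(∑ k, x j k))) = 1 := by
    rw [mul_add, mul_one, Finset.mul_sum, ← h4]
    simp only [← hexp]
  refine ⟨⟨fun j => ?_, fun j k => ?_⟩, fun d' x' h' => ?_⟩
  · rw [eq_div_iff (right_ne_zero_of_mul_eq_one htotal), hexp j]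
    linear_combination Real.exp (-(∑ k, x j k)) * htotal
  · rw [hx, le_div_iff₀ (h5 j), div_le_iff₀ (h5 j)]
    exact h3 j k
  · rw [← MCOP1Obj_mul_eq_MP1Obj, ← MCOP1Obj_mul_eq_MP1Obj, ← hu]
    exact hmax _ _ _ h'.mcop1Feasible
end

section
/- If (d*, d_0*, x*) is an optimal solution to (MP_{1-4}), then (d*, d_0*, x*) is an optimal solution to (MP_{1-2}). -/
open Finset

/-- Feasibility for problem (MP_{1-2}). -/
def MP12Feasible {J K : ℕ} (xl xu : Fin J → Fin K → ℝ)
    (d : Fin J → ℝ) (d0 : ℝ) (x : Fin J → Fin K → ℝ) : Prop :=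
  (∀ j, Real.log (d j / d0) = -(∑ k, x j k)) ∧
  (∀ j k, xl j k ≤ x j k ∧ x j k ≤ xu j k) ∧
  (d0 + ∑ j, d j = 1) ∧
  (∀ j, 0 < d j) ∧ 0 < d0

/-- Optimality for problem (MP_{1-2}); its objective coincides with that of (MP1). -/
def MP12Optimal {J K : ℕ} (φ : Fin J → Fin K → ℝ) (ψ : Fin J → ℝ)
    (xl xu : Fin J → Fin K → ℝ)
    (d : Fin J → ℝ) (d0 : ℝ) (x : Fin J → Fin K → ℝ) : Prop :=
  MP12Feasible xl xu d d0 x ∧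
  ∀ d' d0' x', MP12Feasible xl xu d' d0' x' → MP1Obj φ ψ d' x' ≤ MP1Obj φ ψ d x

/-- Feasibility for problem (MP_{1-4}). -/
def MP14Feasible {J K : ℕ} (xl xu : Fin J → Fin K → ℝ)
    (d : Fin J → ℝ) (d0 : ℝ) (x : Fin J → Fin K → ℝ) : Prop :=
  (∀ j, Real.log (d j / d0) ≤ -(∑ k, x j k)) ∧
  (∀ j, Real.log (d0 / d j) ≤ ∑ k, xu j k) ∧
  (∀ j k, xl j k ≤ x j k ∧ x j k ≤ xu j k) ∧
  (d0 + ∑ j, d j = 1) ∧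
  (∀ j, 0 < d j) ∧ 0 < d0

/-- Optimality for problem (MP_{1-4}); its objective coincides with that of (MP1). -/
def MP14Optimal {J K : ℕ} (φ : Fin J → Fin K → ℝ) (ψ : Fin J → ℝ)
    (xl xu : Fin J → Fin K → ℝ)
    (d : Fin J → ℝ) (d0 : ℝ) (x : Fin J → Fin K → ℝ) : Prop :=
  MP14Feasible xl xu d d0 x ∧
  ∀ d' d0' x', MP14Feasible xl xu d' d0' x' → MP1Obj φ ψ d' x' ≤ MP1Obj φ ψ d x

/-- Raising the single entry `x j k` by `ε` raises the objective by `φ j k * ε * d j`. -/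
theorem MP1Obj_add_single {J K : ℕ} (φ : Fin J → Fin K → ℝ) (ψ : Fin J → ℝ)
    (d : Fin J → ℝ) (x : Fin J → Fin K → ℝ) (j : Fin J) (k : Fin K) (ε : ℝ) :
    MP1Obj φ ψ d (fun i l => x i l + if i = j ∧ l = k then ε else 0) =
      MP1Obj φ ψ d x + φ j k * ε * d j := by
  have hinc : ∑ i, (∑ l, φ i l * if i = j ∧ l = k then ε else 0) * d i = φ j k * ε * d j := by
    rw [Finset.sum_eq_single j (fun i _ hi => by simp [hi]) (by simp)]
    simp
  unfold MP1Obj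
  rw [← hinc, ← Finset.sum_add_distrib]
  refine Finset.sum_congr rfl fun i _ => ?_
  simp only [mul_add, Finset.sum_add_distrib]
  ring

/-- At an optimal solution of (MP_{1-4}) the relaxed logarithmic constraints are tight. -/
theorem MP14Optimal.log_eq {J K : ℕ} {φ : Fin J → Fin K → ℝ} {ψ : Fin J → ℝ}
    {xl xu : Fin J → Fin K → ℝ} {d : Fin J → ℝ} {d0 : ℝ} {x : Fin J → Fin K → ℝ}
    (hφ : ∀ j k, 0 < φ j k) (hopt : MP14Optimal φ ψ xl xu d d0 x) (j : Fin J) :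
    Real.log (d j / d0) = -(∑ k, x j k) := by
  obtain ⟨⟨hlog, hlog', hbox, hsum, hd, hd0⟩, hmax⟩ := hopt
  by_contra hne
  have hlt : Real.log (d j / d0) < -(∑ k, x j k) := lt_of_le_of_ne (hlog j) hne
  have hinv : Real.log (d0 / d j) = -Real.log (d j / d0) := by rw [← Real.log_inv, inv_div]
  obtain ⟨k, -, hk⟩ : ∃ k ∈ Finset.univ, x j k < xu j k :=
    Finset.exists_lt_of_sum_lt (by linarith [hlog' j])
  obtain ⟨ε, hε, hεle⟩ : ∃ ε : ℝ, 0 < ε ∧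
      ε ≤ min (-(∑ k, x j k) - Real.log (d j / d0)) (xu j k - x j k) :=
    ⟨_, lt_min (sub_pos.2 hlt) (sub_pos.2 hk), le_rfl⟩
  obtain ⟨hε_slack, hε_gap⟩ := le_min_iff.1 hεle
  have hle := hmax d d0 (fun i l => x i l + if i = j ∧ l = k then ε else 0)
    ⟨fun i => ?_, hlog', fun i l => ?_, hsum, hd, hd0⟩
  · rw [MP1Obj_add_single] at hle
    linarith [mul_pos (mul_pos (hφ j k) hε) (hd j)]
  · rw [Finset.sum_add_distrib]
    rcases eq_or_ne i j with rfl | hi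
    · simp only [true_and, Finset.sum_ite_eq', Finset.mem_univ, if_true]
      linarith
    · simpa [hi] using hlog i
  · dsimp only
    split_ifs with h
    · obtain ⟨rfl, rfl⟩ := h
      exact ⟨by linarith [(hbox i l).1], by linarith⟩
    · simpa using hbox i l

/-- an optimal solution of (MP_{1-4}) is an optimal solution of (MP_{1-2}). -/
theorem mp14_optimal_to_mp12_optimal (J K : ℕ) (hJ : 0 < J) (hK : 0 < K)
    (φ : Fin J → Fin K → ℝ) (hφ : ∀ j k, 0 < φ j k) (ψ : Fin J → ℝ)
    (xl xu : Fin J → Fin K → ℝ) (hbounds : ∀ j k, xl j k ≤ xu j k)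
    (d : Fin J → ℝ) (d0 : ℝ) (x : Fin J → Fin K → ℝ)
    (hopt : MP14Optimal φ ψ xl xu d d0 x) :
    MP12Optimal φ ψ xl xu d d0 x := by
  refine ⟨⟨hopt.log_eq hφ, hopt.1.2.2.1, hopt.1.2.2.2⟩, fun d' d0' x' h => hopt.2 d' d0' x' ?_⟩
  obtain ⟨hlog, hbox, hrest⟩ := h
  refine ⟨fun j => (hlog j).le, fun j => ?_, hbox, hrest⟩
  rw [← inv_div, Real.log_inv, hlog j, neg_neg]
  exact Finset.sum_le_sum fun k _ => (hbox j k).2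
end

section
/- Let (v, d, u) be a feasible solution to (MCOP2) such that −∑_{k=1}^K u_{jk} = d_j ln(d_j/v_j) for every j = 1,…,J. Define x_{jk} = u_{jk}/d_j for all j, k. Then (v, x) is a feasible solution to (MP2), and its objective value in (MP2) equals the objective value of (v, d, u) in (MCOP2). -/
open Finset

/-- The linear system (S2): `v_j = λ_j + ∑_i ρ_{ij} v_i`. -/
def S2Sol {J : ℕ} (lam : Fin J → ℝ) (ρ : Fin J → Fin J → ℝ) (v : Fin J → ℝ) : Prop :=
  ∀ j, v j = lam j + ∑ i, ρ i j * v i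

/-- Objective of problem (MP2). -/
noncomputable def MP2Obj {J K : ℕ} (φ : Fin J → Fin K → ℝ) (ψ : Fin J → ℝ)
    (v : Fin J → ℝ) (x : Fin J → Fin K → ℝ) : ℝ :=
  ∑ j, (∑ k, φ j k * x j k - ψ j) * Real.exp (-(∑ k, x j k)) * v j

/-- Feasibility for problem (MP2). -/
def MP2Feasible {J K : ℕ} (lam : Fin J → ℝ) (ρ : Fin J → Fin J → ℝ)
    (xl xu : Fin J → Fin K → ℝ) (v : Fin J → ℝ) (x : Fin J → Fin K → ℝ) : Prop :=
  (∀ j, v j = lam j + ∑ i, (1 - Real.exp (-(∑ k, x i k))) * ρ i j * v i) ∧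
  (∀ j k, xl j k ≤ x j k ∧ x j k ≤ xu j k)

/-- Optimality for problem (MP2). -/
def MP2Optimal {J K : ℕ} (φ : Fin J → Fin K → ℝ) (ψ : Fin J → ℝ)
    (lam : Fin J → ℝ) (ρ : Fin J → Fin J → ℝ)
    (xl xu : Fin J → Fin K → ℝ) (v : Fin J → ℝ) (x : Fin J → Fin K → ℝ) : Prop :=
  MP2Feasible lam ρ xl xu v x ∧
  ∀ v' x', MP2Feasible lam ρ xl xu v' x' → MP2Obj φ ψ v' x' ≤ MP2Obj φ ψ v x

/-- Objective of problems (MCOP2) and (MCP2). -/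
noncomputable def MCOP2Obj {J K : ℕ} (φ : Fin J → Fin K → ℝ) (ψ : Fin J → ℝ)
    (d : Fin J → ℝ) (u : Fin J → Fin K → ℝ) : ℝ :=
  ∑ j, (∑ k, φ j k * u j k - ψ j * d j)

/-- Feasibility for problem (MCOP2). -/
def MCOP2Feasible {J K : ℕ} (lam : Fin J → ℝ) (ρ : Fin J → Fin J → ℝ)
    (xl xu : Fin J → Fin K → ℝ)
    (v d : Fin J → ℝ) (u : Fin J → Fin K → ℝ) : Prop :=
  (∀ j, v j = lam j + ∑ i, ρ i j * (v i - d i)) ∧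
  (∀ j, d j * Real.log (d j / v j) ≤ -(∑ k, u j k)) ∧
  (∀ j, v j * Real.log (v j / d j) ≤ v j * ∑ k, xu j k) ∧
  (∀ j k, xl j k * d j ≤ u j k ∧ u j k ≤ xu j k * d j) ∧
  (∀ j, 0 < d j) ∧ (∀ j, 0 < v j)

/-- Optimality for problem (MCOP2). -/
def MCOP2Optimal {J K : ℕ} (φ : Fin J → Fin K → ℝ) (ψ : Fin J → ℝ)
    (lam : Fin J → ℝ) (ρ : Fin J → Fin J → ℝ) (xl xu : Fin J → Fin K → ℝ)
    (v d : Fin J → ℝ) (u : Fin J → Fin K → ℝ) : Prop :=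
  MCOP2Feasible lam ρ xl xu v d u ∧
  ∀ v' d' u', MCOP2Feasible lam ρ xl xu v' d' u' → MCOP2Obj φ ψ d' u' ≤ MCOP2Obj φ ψ d u

/-- If `a = d * log (d / v)` with `d, v > 0`, then `exp (a / d) * v = d`. -/
lemma exp_div_mul_eq_of_eq_mul_log {a d v : ℝ} (hd : 0 < d) (hv : 0 < v)
    (h : a = d * Real.log (d / v)) : Real.exp (a / d) * v = d := by
  rw [h, mul_div_cancel_left₀ _ hd.ne', Real.exp_log (div_pos hd hv), div_mul_cancel₀ _ hv.ne']

/-- a feasible solution of (MCOP2) at which the first family of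
inequality constraints is tight transforms into a feasible solution of (MP2)
with the same objective value. -/
theorem mcop2_to_mp2 (J K : ℕ) (hJ : 0 < J) (hK : 0 < K)
    (φ : Fin J → Fin K → ℝ) (hφ : ∀ j k, 0 < φ j k) (ψ : Fin J → ℝ)
    (lam : Fin J → ℝ) (hlam : ∀ j, 0 ≤ lam j)
    (ρ : Fin J → Fin J → ℝ) (hρ : ∀ i j, 0 ≤ ρ i j)
    (xl xu : Fin J → Fin K → ℝ) (hxl : ∀ j k, 0 ≤ xl j k)
    (hbounds : ∀ j k, xl j k ≤ xu j k)
    (v d : Fin J → ℝ) (u : Fin J → Fin K → ℝ)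
    (hfeas : MCOP2Feasible lam ρ xl xu v d u)
    (htight : ∀ j, -(∑ k, u j k) = d j * Real.log (d j / v j))
    (x : Fin J → Fin K → ℝ) (hx : ∀ j k, x j k = u j k / d j) :
    MP2Feasible lam ρ xl xu v x ∧ MP2Obj φ ψ v x = MCOP2Obj φ ψ d u := by
  obtain ⟨hflow, -, -, hu, hd, hv⟩ := hfeas
  have hexp : ∀ j, Real.exp (-(∑ k, x j k)) * v j = d j := fun j => by
    have hsum : -(∑ k, x j k) = -(∑ k, u j k) / d j := by
      simp only [hx, ← Finset.sum_div, neg_div]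
    rw [hsum]
    exact exp_div_mul_eq_of_eq_mul_log (hd j) (hv j) (htight j)
  refine ⟨⟨fun j => ?_, fun j k => ?_⟩, Finset.sum_congr rfl fun j _ => ?_⟩
  · rw [hflow j]
    congr 1
    refine Finset.sum_congr rfl fun i _ => ?_
    linear_combination ρ i j * hexp i
  · rw [hx, le_div_iff₀ (hd j), div_le_iff₀ (hd j)]
    exact hu j k
  · rw [mul_assoc, hexp, sub_mul, Finset.sum_mul]
    congr 1
    refine Finset.sum_congr rfl fun k _ => ?_
    rw [hx, mul_assoc, div_mul_cancel₀ _ (hd j).ne']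
end

section
/- Let (v*, d*, u*) be an optimal solution to (MCOP2). Then for every j = 1,…,J, the first family of inequality constraints holds with equality: −∑_{k=1}^K u_{jk}* = d_j* ln(d_j*/v_j*). -/
open Finset

/-- Increasing one coordinate `u j k` by `ε` increases the objective by `φ j k * ε`. -/
theorem MCOP2Obj_increase_u {J K : ℕ} (φ : Fin J → Fin K → ℝ) (ψ d : Fin J → ℝ)
    (u : Fin J → Fin K → ℝ) (j : Fin J) (k : Fin K) (ε : ℝ) :
    MCOP2Obj φ ψ d (fun i l => u i l + if i = j ∧ l = k then ε else 0) =
      MCOP2Obj φ ψ d u + φ j k * ε := by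
  simp [MCOP2Obj, mul_add, Finset.sum_add_distrib, ite_and, Finset.sum_sub_distrib]
  ring

/-- Feasibility is preserved when one coordinate `u j k` is increased within the available slack. -/
theorem MCOP2Feasible.increase_u {J K : ℕ} {lam : Fin J → ℝ} {ρ : Fin J → Fin J → ℝ}
    {xl xu : Fin J → Fin K → ℝ} {v d : Fin J → ℝ} {u : Fin J → Fin K → ℝ}
    (h : MCOP2Feasible lam ρ xl xu v d u) {j : Fin J} {k : Fin K} {ε : ℝ} (hε : 0 ≤ ε)
    (hbox : u j k + ε ≤ xu j k * d j)
    (hlog : d j * Real.log (d j / v j) ≤ -(∑ l, u j l + ε)) :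
    MCOP2Feasible lam ρ xl xu v d (fun i l => u i l + if i = j ∧ l = k then ε else 0) := by
  obtain ⟨hflow, hent, hupper, hu, hpos⟩ := h
  refine ⟨hflow, fun i => ?_, hupper, fun i l => ?_, hpos⟩
  · by_cases hi : i = j
    · subst hi
      simpa [Finset.sum_add_distrib] using hlog
    · simpa [hi] using hent i
  · dsimp only
    split_ifs with hil
    · obtain ⟨rfl, rfl⟩ := hil
      exact ⟨by linarith [(hu i l).1], hbox⟩
    · simpa using hu i l

/-- at an optimal solution of (MCOP2), the first family of
inequality constraints holds with equality. -/
theorem mcop2_tight_at_optimum (J K : ℕ) (hJ : 0 < J) (hK : 0 < K)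
    (φ : Fin J → Fin K → ℝ) (hφ : ∀ j k, 0 < φ j k) (ψ : Fin J → ℝ)
    (lam : Fin J → ℝ) (hlam : ∀ j, 0 ≤ lam j)
    (ρ : Fin J → Fin J → ℝ) (hρ : ∀ i j, 0 ≤ ρ i j)
    (xl xu : Fin J → Fin K → ℝ) (hxl : ∀ j k, 0 ≤ xl j k)
    (hbounds : ∀ j k, xl j k ≤ xu j k)
    (v d : Fin J → ℝ) (u : Fin J → Fin K → ℝ)
    (hopt : MCOP2Optimal φ ψ lam ρ xl xu v d u) :
    ∀ j, -(∑ k, u j k) = d j * Real.log (d j / v j) := by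
  obtain ⟨hfeas, hmax⟩ := hopt
  have hupper := hfeas.2.2.1
  have hbox := hfeas.2.2.2.1
  intro j
  have hd : 0 < d j := hfeas.2.2.2.2.1 j
  have hv : 0 < v j := hfeas.2.2.2.2.2 j
  by_contra hne
  have hslack : d j * Real.log (d j / v j) < -(∑ k, u j k) :=
    lt_of_le_of_ne (hfeas.2.1 j) (Ne.symm hne)
  obtain ⟨k, hk⟩ : ∃ k, u j k < xu j k * d j := by
    by_contra! hfull
    have hsum : ∑ k, u j k = (∑ k, xu j k) * d j := by
      rw [Finset.sum_mul]
      exact Finset.sum_congr rfl fun k _ => le_antisymm (hbox j k).2 (hfull k)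
    have hlog : Real.log (v j / d j) ≤ ∑ k, xu j k := le_of_mul_le_mul_left (hupper j) hv
    have hinv : Real.log (d j / v j) = -Real.log (v j / d j) := by
      rw [← Real.log_inv, inv_div]
    rw [hinv, hsum] at hslack
    nlinarith [mul_le_mul_of_nonneg_left hlog hd.le]
  obtain ⟨ε, hεpos, hε⟩ : ∃ ε, 0 < ε ∧
      ε ≤ min (xu j k * d j - u j k) (-(∑ k, u j k) - d j * Real.log (d j / v j)) :=
    ⟨_, lt_min (by linarith) (by linarith), le_rfl⟩
  obtain ⟨hεbox, hεlog⟩ := le_min_iff.mp hε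
  have hincr := hmax v d _ (hfeas.increase_u (j := j) (k := k) hεpos.le
    (by linarith) (by linarith))
  rw [MCOP2Obj_increase_u] at hincr
  linarith [mul_pos (hφ j k) hεpos]
end

section
/- Assume the linear system (S2) has a unique solution which is strictly positive. Suppose (v*, d*, u*) is an optimal solution to (MCOP2). Define x_{jk}* = u_{jk}*/d_j* for all j = 1,…,J and k = 1,…,K. Then (v*, x*) is an optimal solution to (MP2). -/
open Finset

/-- If (S2) has a unique solution and it is positive, then every subsolution of the homogeneous
system is nonpositive. -/
theorem subsolution_nonpos {J : ℕ} {lam : Fin J → ℝ} {ρ : Fin J → Fin J → ℝ}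
    (hlam : ∀ j, 0 ≤ lam j) (hρ : ∀ i j, 0 ≤ ρ i j) {w : Fin J → ℝ}
    (hw : S2Sol lam ρ w) (hwpos : ∀ j, 0 < w j) (huniq : ∀ w', S2Sol lam ρ w' → w' = w)
    {z : Fin J → ℝ} (hz : ∀ j, z j ≤ ∑ i, ρ i j * z i) (j : Fin J) : z j ≤ 0 := by
  set T : (Fin J → ℝ) → Fin J → ℝ := fun y j => ∑ i, ρ i j * y i with hT
  have hTmono : Monotone T := fun a b hab j =>
    Finset.sum_le_sum fun i _ => mul_le_mul_of_nonneg_left (hab i) (hρ i j)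
  have hmono : Monotone fun n => T^[n] z :=
    hTmono.monotone_iterate_of_le_map (f := T) (x := z) hz
  obtain ⟨C, hC0, hC⟩ : ∃ C : ℝ, 0 ≤ C ∧ ∀ j, z j ≤ C * w j := by
    have hnn : ∀ i ∈ Finset.univ, 0 ≤ |z i| / w i := fun i _ =>
      div_nonneg (abs_nonneg _) (hwpos i).le
    refine ⟨∑ i, |z i| / w i, Finset.sum_nonneg hnn, fun j => ?_⟩
    calc z j ≤ |z j| / w j * w j := by
          rw [div_mul_cancel₀ _ (hwpos j).ne']
          exact le_abs_self _
      _ ≤ _ := mul_le_mul_of_nonneg_right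
          (Finset.single_le_sum hnn (Finset.mem_univ j)) (hwpos j).le
  have hbdd : ∀ n j, T^[n] z j ≤ C * w j := by
    intro n
    induction n with
    | zero => exact hC
    | succ n ih =>
      intro j
      rw [Function.iterate_succ_apply']
      calc T (T^[n] z) j ≤ T (fun i => C * w i) j := hTmono ih j
        _ = C * ∑ i, ρ i j * w i := by
          rw [hT, Finset.mul_sum]
          exact Finset.sum_congr rfl fun i _ => by ring
        _ ≤ C * w j := by
          refine mul_le_mul_of_nonneg_left ?_ hC0
          linarith [hw j, hlam j]
  have hlim : ∀ j, Filter.Tendsto (fun n => T^[n] z j) Filter.atTop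
      (nhds (⨆ n, T^[n] z j)) := fun j =>
    tendsto_atTop_ciSup (fun _ _ h => hmono h j) ⟨C * w j, by rintro _ ⟨n, rfl⟩; exact hbdd n j⟩
  set y : Fin J → ℝ := fun j => ⨆ n, T^[n] z j
  have hfix : ∀ j, y j = ∑ i, ρ i j * y i := by
    intro j
    refine tendsto_nhds_unique ((Filter.tendsto_add_atTop_iff_nat 1).2 (hlim j)) ?_
    simp only [Function.iterate_succ_apply']
    exact tendsto_finsetSum _ fun i _ => (hlim i).const_mul _
  have hwy : w + y = w := huniq _ fun j => by
    simp only [Pi.add_apply, mul_add, Finset.sum_add_distrib]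
    linarith [hw j, hfix j]
  have hy : y j = 0 := by simpa using congrFun hwy j
  have hzy : z j ≤ y j :=
    (show Monotone fun n => T^[n] z j from fun _ _ h => hmono h j).ge_of_tendsto (hlim j) 0
  exact hzy.trans_eq hy

/-- Every (MP2)-feasible `v` is nonnegative. -/
theorem MP2Feasible.nonneg {J K : ℕ} {lam : Fin J → ℝ} {ρ : Fin J → Fin J → ℝ}
    {xl xu : Fin J → Fin K → ℝ} (hlam : ∀ j, 0 ≤ lam j) (hρ : ∀ i j, 0 ≤ ρ i j)
    (hxl : ∀ j k, 0 ≤ xl j k)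
    (hS2 : ∃ w : Fin J → ℝ, S2Sol lam ρ w ∧ (∀ j, 0 < w j) ∧ ∀ w', S2Sol lam ρ w' → w' = w)
    {v : Fin J → ℝ} {x : Fin J → Fin K → ℝ} (h : MP2Feasible lam ρ xl xu v x) (j : Fin J) :
    0 ≤ v j := by
  obtain ⟨w, hw, hwpos, huniq⟩ := hS2
  have hsub : ∀ j, max (-v j) 0 ≤ ∑ i, ρ i j * max (-v i) 0 := by
    intro j
    refine max_le ?_ (Finset.sum_nonneg fun i _ => mul_nonneg (hρ i j) (le_max_right _ _))
    have hle : -∑ i, (1 - Real.exp (-(∑ k, x i k))) * ρ i j * v i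
        ≤ ∑ i, ρ i j * max (-v i) 0 := by
      rw [← Finset.sum_neg_distrib]
      refine Finset.sum_le_sum fun i _ => ?_
      have hs : 0 ≤ ∑ k, x i k := Finset.sum_nonneg fun k _ => (hxl i k).trans (h.2 i k).1
      have he : Real.exp (-(∑ k, x i k)) ≤ 1 := Real.exp_le_one_iff.2 (by linarith)
      have hpos := Real.exp_pos (-(∑ k, x i k))
      calc -((1 - Real.exp (-(∑ k, x i k))) * ρ i j * v i)
          = ρ i j * ((1 - Real.exp (-(∑ k, x i k))) * -v i) := by ring
        _ ≤ ρ i j * max (-v i) 0 := by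
          refine mul_le_mul_of_nonneg_left ?_ (hρ i j)
          calc (1 - Real.exp (-(∑ k, x i k))) * -v i
              ≤ (1 - Real.exp (-(∑ k, x i k))) * max (-v i) 0 :=
                mul_le_mul_of_nonneg_left (le_max_left _ _) (by linarith)
            _ ≤ max (-v i) 0 := mul_le_of_le_one_left (le_max_right _ _) (by linarith)
    linarith [h.1 j, hlam j]
  have := (le_max_left (-v j) 0).trans
    (subsolution_nonpos hlam hρ hw hwpos huniq (z := fun j => max (-v j) 0) hsub j)
  linarith

/-- Optimality in (MCOP2) forces the entropy constraint to be tight. -/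
theorem MCOP2Optimal.d_eq {J K : ℕ} {φ : Fin J → Fin K → ℝ} (hφ : ∀ j k, 0 < φ j k)
    {ψ lam : Fin J → ℝ} {ρ : Fin J → Fin J → ℝ} {xl xu : Fin J → Fin K → ℝ}
    {v d : Fin J → ℝ} {u : Fin J → Fin K → ℝ} (hopt : MCOP2Optimal φ ψ lam ρ xl xu v d u)
    (j : Fin J) : d j = v j * Real.exp (-(∑ k, u j k / d j)) := by
  obtain ⟨⟨h1, h2, h3, h4, hd, hv⟩, hmax⟩ := hopt
  have hdj := hd j
  have hvj := hv j
  have hsum : d j * ∑ k, u j k / d j = ∑ k, u j k := by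
    rw [← Finset.sum_div, mul_div_cancel₀ _ hdj.ne']
  have hkey : d j * Real.log (d j / v j) = -∑ k, u j k := by
    refine (h2 j).antisymm (le_of_not_gt fun hlt => ?_)
    by_cases hex : ∃ k, u j k < xu j k * d j
    · obtain ⟨k, hk⟩ := hex
      obtain ⟨ε, hε, hε1, hε2⟩ : ∃ ε > 0, ε ≤ xu j k * d j - u j k ∧
          ε ≤ -∑ k, u j k - d j * Real.log (d j / v j) :=
        ⟨min _ _, lt_min (sub_pos.2 hk) (sub_pos.2 hlt), min_le_left _ _, min_le_right _ _⟩
      set e : Fin J → Fin K → ℝ := Pi.single j (Pi.single k ε) with he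
      have hejk : e j = Pi.single k ε := by simp [he]
      have hej : ∀ i, i ≠ j → e i = 0 := fun i hi => by simp [he, hi]
      have henn : ∀ i l, 0 ≤ e i l := by
        intro i l
        rcases eq_or_ne i j with rfl | hi
        · rw [hejk]
          rcases eq_or_ne l k with rfl | hl
          · simpa using hε.le
          · simp [hl]
        · simp [hej i hi]
      have hfeas : MCOP2Feasible lam ρ xl xu v d (u + e) := by
        refine ⟨h1, fun i => ?_, h3, fun i l => ⟨?_, ?_⟩, hd, hv⟩
        · rcases eq_or_ne i j with rfl | hi
          · simp only [Pi.add_apply, Finset.sum_add_distrib, hejk, Finset.sum_pi_single',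
              Finset.mem_univ, if_true]
            linarith
          · simpa [hej i hi] using h2 i
        · exact (h4 i l).1.trans (le_add_of_nonneg_right (henn i l))
        · rcases eq_or_ne i j with rfl | hi
          · rcases eq_or_ne l k with rfl | hl
            · simp only [Pi.add_apply, hejk, Pi.single_eq_same]
              linarith
            · simpa [hejk, hl] using (h4 i l).2
          · simpa [hej i hi] using (h4 i l).2
      refine (hmax v d (u + e) hfeas).not_gt ?_
      have hle : ∀ i l, φ i l * u i l ≤ φ i l * (u + e) i l := fun i l =>
        mul_le_mul_of_nonneg_left (le_add_of_nonneg_right (henn i l)) (hφ i l).le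
      refine Finset.sum_lt_sum
        (fun i _ => sub_le_sub_right (Finset.sum_le_sum fun l _ => hle i l) _)
        ⟨j, Finset.mem_univ j, sub_lt_sub_right (Finset.sum_lt_sum (fun l _ => hle j l)
          ⟨k, Finset.mem_univ k, mul_lt_mul_of_pos_left ?_ (hφ j k)⟩) _⟩
      simpa [hejk] using hε
    · push Not at hex
      have hu : ∑ k, u j k = d j * ∑ k, xu j k := by
        rw [Finset.mul_sum]
        exact Finset.sum_congr rfl fun k _ => by linarith [hex k, (h4 j k).2]
      have h3' : Real.log (v j / d j) ≤ ∑ k, xu j k := le_of_mul_le_mul_left (h3 j) hvj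
      have hlog : Real.log (d j / v j) = -Real.log (v j / d j) := by
        rw [← Real.log_inv, inv_div]
      rw [hlog, hu] at hlt
      nlinarith
  have hlog : Real.log (d j / v j) = -∑ k, u j k / d j := by
    refine mul_left_cancel₀ hdj.ne' ?_
    rw [hkey, mul_neg, hsum]
  rw [← hlog, Real.exp_log (div_pos hdj hvj), mul_div_cancel₀ _ hvj.ne']

/-- Convexity of the relative entropy constraint, along pairs where it is tight. -/
theorem mul_log_div_add_le {a b s t : ℝ} (ha : 0 ≤ a) (hb : 0 < b) :
    (a + b) * Real.log ((a + b) / (a * Real.exp s + b * Real.exp t)) ≤ -(a * s + b * t) := by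
  have hab : 0 < a + b := by linarith
  have hden : 0 < a * Real.exp s + b * Real.exp t := by positivity
  set m := (a * s + b * t) / (a + b) with hm
  have hmab : (a + b) * m = a * s + b * t := mul_div_cancel₀ _ hab.ne'
  have htan : ∀ r, Real.exp m * (r - m + 1) ≤ Real.exp r := fun r => by
    calc Real.exp m * (r - m + 1) ≤ Real.exp m * Real.exp (r - m) :=
          mul_le_mul_of_nonneg_left (Real.add_one_le_exp _) (Real.exp_pos m).le
      _ = Real.exp r := by rw [← Real.exp_add]; ring_nf
  have hle : (a + b) * Real.exp m ≤ a * Real.exp s + b * Real.exp t := by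
    have h1 := mul_le_mul_of_nonneg_left (htan s) ha
    have h2 := mul_le_mul_of_nonneg_left (htan t) hb.le
    have h3 : a * (Real.exp m * (s - m + 1)) + b * (Real.exp m * (t - m + 1))
        = (a + b) * Real.exp m + Real.exp m * (a * s + b * t - (a + b) * m) := by ring
    rw [hmab, sub_self, mul_zero, add_zero] at h3
    linarith
  rw [← hmab, ← mul_neg]
  refine mul_le_mul_of_nonneg_left ?_ hab.le
  rw [Real.log_le_iff_le_exp (div_pos hab hden), Real.exp_neg, div_le_iff₀ hden,
    le_inv_mul_iff₀ (Real.exp_pos m)]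
  linarith

/-- an optimal solution of (MCOP2) transforms into an optimal
solution of (MP2) via `x_{jk} = u_{jk} / d_j`. -/
theorem mcop2_optimal_to_mp2_optimal (J K : ℕ) (hJ : 0 < J) (hK : 0 < K)
    (φ : Fin J → Fin K → ℝ) (hφ : ∀ j k, 0 < φ j k) (ψ : Fin J → ℝ)
    (lam : Fin J → ℝ) (hlam : ∀ j, 0 ≤ lam j)
    (ρ : Fin J → Fin J → ℝ) (hρ : ∀ i j, 0 ≤ ρ i j)
    (xl xu : Fin J → Fin K → ℝ) (hxl : ∀ j k, 0 ≤ xl j k)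
    (hbounds : ∀ j k, xl j k ≤ xu j k)
    (hS2 : ∃ w : Fin J → ℝ, S2Sol lam ρ w ∧ (∀ j, 0 < w j) ∧
      ∀ w', S2Sol lam ρ w' → w' = w)
    (v d : Fin J → ℝ) (u : Fin J → Fin K → ℝ)
    (hopt : MCOP2Optimal φ ψ lam ρ xl xu v d u)
    (x : Fin J → Fin K → ℝ) (hx : ∀ j k, x j k = u j k / d j) :
    MP2Optimal φ ψ lam ρ xl xu v x := by
  have hd := hopt.1.2.2.2.2.1
  have hv := hopt.1.2.2.2.2.2
  have hdx : ∀ j, d j = v j * Real.exp (-(∑ k, x j k)) := fun j => by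
    simp only [hx]
    exact hopt.d_eq hφ j
  have hux : ∀ j k, u j k = x j k * d j := fun j k => by
    rw [hx, div_mul_cancel₀ _ (hd j).ne']
  have hobj : ∀ (v' d' : Fin J → ℝ) (x' u' : Fin J → Fin K → ℝ),
      (∀ j, d' j = v' j * Real.exp (-(∑ k, x' j k))) → (∀ j k, u' j k = x' j k * d' j) →
      MP2Obj φ ψ v' x' = MCOP2Obj φ ψ d' u' := by
    intro v' d' x' u' hd' hu'
    refine Finset.sum_congr rfl fun j _ => ?_
    have hs : ∑ k, φ j k * u' j k = (∑ k, φ j k * x' j k) * d' j := by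
      rw [Finset.sum_mul]
      exact Finset.sum_congr rfl fun k _ => by rw [hu', mul_assoc]
    rw [hs, hd']
    ring
  have hfeas : MP2Feasible lam ρ xl xu v x := by
    refine ⟨fun j => ?_, fun j k => ?_⟩
    · refine (hopt.1.1 j).trans (congrArg _ (Finset.sum_congr rfl fun i _ => ?_))
      rw [hdx i]
      ring
    · have h := hopt.1.2.2.2.1 j k
      rw [hux] at h
      exact ⟨le_of_mul_le_mul_right h.1 (hd j), le_of_mul_le_mul_right h.2 (hd j)⟩
  refine ⟨hfeas, fun v' x' h' => ?_⟩
  have hv' := h'.nonneg hlam hρ hxl hS2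
  set d' : Fin J → ℝ := fun j => v' j * Real.exp (-(∑ k, x' j k)) with hd'
  set u' : Fin J → Fin K → ℝ := fun j k => x' j k * d' j with hu'
  have hd'0 : ∀ j, 0 ≤ d' j := fun j => mul_nonneg (hv' j) (Real.exp_pos _).le
  have hvd : ∀ j, v j = d j * Real.exp (∑ k, x j k) := fun j => by
    rw [hdx j, mul_assoc, ← Real.exp_add, neg_add_cancel, Real.exp_zero, mul_one]
  have hvd' : ∀ j, v' j = d' j * Real.exp (∑ k, x' j k) := fun j => by
    rw [hd', mul_assoc, ← Real.exp_add, neg_add_cancel, Real.exp_zero, mul_one]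
  have hsum : ∀ j, ∑ k, u j k = d j * ∑ k, x j k := fun j => by
    rw [Finset.mul_sum]
    exact Finset.sum_congr rfl fun k _ => by rw [hux, mul_comm]
  have hsum' : ∀ j, ∑ k, u' j k = d' j * ∑ k, x' j k := fun j => by
    rw [Finset.mul_sum]
    exact Finset.sum_congr rfl fun k _ => mul_comm _ _
  -- The midpoint with the given optimum is (MCOP2)-feasible even when the other point has zero entries.
  have hmid : MCOP2Feasible lam ρ xl xu (fun j => (v' j + v j) / 2) (fun j => (d' j + d j) / 2)
      (fun j k => (u' j k + u j k) / 2) := by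
    have hdpos : ∀ j, 0 < d' j + d j := fun j => add_pos_of_nonneg_of_pos (hd'0 j) (hd j)
    have hvpos : ∀ j, 0 < v' j + v j := fun j => add_pos_of_nonneg_of_pos (hv' j) (hv j)
    refine ⟨fun j => ?_, fun j => ?_, fun j => ?_, fun j k => ?_,
      fun j => half_pos (hdpos j), fun j => half_pos (hvpos j)⟩
    · have e1 := hopt.1.1 j
      have e2 : v' j = lam j + ∑ i, ρ i j * (v' i - d' i) := by
        refine (h'.1 j).trans (congrArg _ (Finset.sum_congr rfl fun i _ => ?_))
        simp only [hd']
        ring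
      have e3 : ∑ i, ρ i j * ((v' i + v i) / 2 - (d' i + d i) / 2)
          = (∑ i, ρ i j * (v' i - d' i) + ∑ i, ρ i j * (v i - d i)) / 2 := by
        rw [← Finset.sum_add_distrib, Finset.sum_div]
        exact Finset.sum_congr rfl fun i _ => by ring
      rw [e3]
      linarith
    · have h := mul_log_div_add_le (s := ∑ k, x' j k) (t := ∑ k, x j k) (hd'0 j) (hd j)
      rw [← hvd, ← hvd', ← hsum, ← hsum'] at h
      rw [div_div_div_cancel_right₀ two_ne_zero, ← Finset.sum_div, Finset.sum_add_distrib]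
      linarith
    · refine mul_le_mul_of_nonneg_left ?_ (half_pos (hvpos j)).le
      rw [div_div_div_cancel_right₀ two_ne_zero,
        Real.log_le_iff_le_exp (div_pos (hvpos j) (hdpos j)), div_le_iff₀ (hdpos j)]
      have b : Real.exp (∑ k, x j k) ≤ Real.exp (∑ k, xu j k) :=
        Real.exp_le_exp.2 (Finset.sum_le_sum fun k _ => (hfeas.2 j k).2)
      have b' : Real.exp (∑ k, x' j k) ≤ Real.exp (∑ k, xu j k) :=
        Real.exp_le_exp.2 (Finset.sum_le_sum fun k _ => (h'.2 j k).2)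
      linarith [mul_le_mul_of_nonneg_left b (hd j).le, mul_le_mul_of_nonneg_left b' (hd'0 j),
        hvd j, hvd' j]
    · have h := hopt.1.2.2.2.1 j k
      have l' : xl j k * d' j ≤ u' j k := mul_le_mul_of_nonneg_right (h'.2 j k).1 (hd'0 j)
      have r' : u' j k ≤ xu j k * d' j := mul_le_mul_of_nonneg_right (h'.2 j k).2 (hd'0 j)
      constructor <;> linarith [h.1, h.2]
  have hle := hopt.2 _ _ _ hmid
  have hlin : MCOP2Obj φ ψ (fun j => (d' j + d j) / 2) (fun j k => (u' j k + u j k) / 2)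
      = (MCOP2Obj φ ψ d' u' + MCOP2Obj φ ψ d u) / 2 := by
    unfold MCOP2Obj
    rw [← Finset.sum_add_distrib, Finset.sum_div]
    refine Finset.sum_congr rfl fun j _ => ?_
    have hs : ∑ k, φ j k * ((u' j k + u j k) / 2)
        = (∑ k, φ j k * u' j k + ∑ k, φ j k * u j k) / 2 := by
      rw [← Finset.sum_add_distrib, Finset.sum_div]
      exact Finset.sum_congr rfl fun k _ => by ring
    rw [hs]
    ring
  rw [hobj v' d' x' u' (fun _ => rfl) (fun _ _ => rfl), hobj v d x u hdx hux]
  linarith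
end

section
/- Suppose (d*, p*, v*) is an optimal solution to (MCOP3), assumption (A3) holds, and the system (S3) evaluated at (d*, p*, v*) has a solution u*. Define x*^[i]_{jk} = u*^[i]_{jk} / d*^[i]_j for all (i,j) ∈ IJ and k = 1,…,K. Then (d*, x*) is an optimal solution to (MP3). -/
open Finset

/-- Nest aggregate `∑_{j ∈ J^[i]} exp(−(∑_k x^[i]_{jk}) / γ^[i])`. -/
noncomputable def nestSum {I K : ℕ} {Jn : Fin I → ℕ} (γ : Fin I → ℝ)
    (x : ∀ i : Fin I, Fin (Jn i) → Fin K → ℝ) (i : Fin I) : ℝ :=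
  ∑ j, Real.exp (-(∑ k, x i j k) / γ i)

/-- Objective of problem (MP3). -/
noncomputable def MP3Obj {I K : ℕ} {Jn : Fin I → ℕ}
    (φ : ∀ i : Fin I, Fin (Jn i) → Fin K → ℝ) (ψ : ∀ i : Fin I, Fin (Jn i) → ℝ)
    (d : ∀ i : Fin I, Fin (Jn i) → ℝ) (x : ∀ i : Fin I, Fin (Jn i) → Fin K → ℝ) : ℝ :=
  ∑ i, ∑ j, (∑ k, φ i j k * x i j k - ψ i j) * d i j

/-- Feasibility for problem (MP3) (nested logit choice probabilities and box bounds). -/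
def MP3Feasible {I K : ℕ} {Jn : Fin I → ℕ} (γ : Fin I → ℝ)
    (xl xu : ∀ i : Fin I, Fin (Jn i) → Fin K → ℝ)
    (d : ∀ i : Fin I, Fin (Jn i) → ℝ) (x : ∀ i : Fin I, Fin (Jn i) → Fin K → ℝ) : Prop :=
  (∀ i j, d i j =
      (nestSum γ x i) ^ (γ i) / (1 + ∑ i', (nestSum γ x i') ^ (γ i')) *
        (Real.exp (-(∑ k, x i j k) / γ i) / nestSum γ x i)) ∧
  (∀ i j k, xl i j k ≤ x i j k ∧ x i j k ≤ xu i j k)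

/-- Optimality for problem (MP3). -/
def MP3Optimal {I K : ℕ} {Jn : Fin I → ℕ}
    (φ : ∀ i : Fin I, Fin (Jn i) → Fin K → ℝ) (ψ : ∀ i : Fin I, Fin (Jn i) → ℝ)
    (γ : Fin I → ℝ) (xl xu : ∀ i : Fin I, Fin (Jn i) → Fin K → ℝ)
    (d : ∀ i : Fin I, Fin (Jn i) → ℝ) (x : ∀ i : Fin I, Fin (Jn i) → Fin K → ℝ) : Prop :=
  MP3Feasible γ xl xu d x ∧
  ∀ d' x', MP3Feasible γ xl xu d' x' → MP3Obj φ ψ d' x' ≤ MP3Obj φ ψ d x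

/-- Objective of problems (MCOP3) and (MCP3). -/
noncomputable def MCOP3Obj {I K : ℕ} {Jn : Fin I → ℕ}
    (ρ : Fin I → Fin K → ℝ) (ψ : ∀ i : Fin I, Fin (Jn i) → ℝ)
    (d : ∀ i : Fin I, Fin (Jn i) → ℝ) (v : Fin I → Fin K → ℝ) : ℝ :=
  ∑ i, (∑ k, ρ i k * v i k - ∑ j, ψ i j * d i j)

/-- Feasibility for problem (MCOP3). -/
def MCOP3Feasible {I K : ℕ} {Jn : Fin I → ℕ} (γ : Fin I → ℝ)
    (xl xu : ∀ i : Fin I, Fin (Jn i) → Fin K → ℝ)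
    (d : ∀ i : Fin I, Fin (Jn i) → ℝ) (p0 : ℝ) (p : Fin I → ℝ)
    (v : Fin I → Fin K → ℝ) : Prop :=
  (∀ i, γ i * ∑ j, d i j * Real.log (d i j / p0) +
      (1 - γ i) * p i * Real.log (p i / p0) ≤ -(∑ k, v i k)) ∧
  (∀ i j, γ i * p0 * Real.log (p0 / d i j) +
      (1 - γ i) * p0 * Real.log (p0 / p i) ≤ p0 * ∑ k, xu i j k) ∧
  (∀ i k, (∑ j, xl i j k * d i j) ≤ v i k ∧ v i k ≤ ∑ j, xu i j k * d i j) ∧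
  (∀ i, p i = ∑ j, d i j) ∧
  (p0 + ∑ i, p i = 1) ∧
  (0 < p0) ∧ (∀ i, 0 < p i) ∧ (∀ i j, 0 < d i j)

/-- Optimality for problem (MCOP3). -/
def MCOP3Optimal {I K : ℕ} {Jn : Fin I → ℕ}
    (ρ : Fin I → Fin K → ℝ) (ψ : ∀ i : Fin I, Fin (Jn i) → ℝ) (γ : Fin I → ℝ)
    (xl xu : ∀ i : Fin I, Fin (Jn i) → Fin K → ℝ)
    (d : ∀ i : Fin I, Fin (Jn i) → ℝ) (p0 : ℝ) (p : Fin I → ℝ)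
    (v : Fin I → Fin K → ℝ) : Prop :=
  MCOP3Feasible γ xl xu d p0 p v ∧
  ∀ d' p0' p' v', MCOP3Feasible γ xl xu d' p0' p' v' →
    MCOP3Obj ρ ψ d' v' ≤ MCOP3Obj ρ ψ d v

/-- Assumption (A3): within every nest, all products share the same positive
adjusted profit margin `ρ^[i]_k` for each attribute `k`. -/
def A3 {I K : ℕ} {Jn : Fin I → ℕ}
    (φ : ∀ i : Fin I, Fin (Jn i) → Fin K → ℝ) (ρ : Fin I → Fin K → ℝ) : Prop :=
  ∀ (i : Fin I) (k : Fin K), 0 < ρ i k ∧ ∀ j : Fin (Jn i), φ i j k = ρ i k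

/-- The system (S3) (given `(d, p0, p, v)`, `u` is the unknown). -/
def S3Sol {I K : ℕ} {Jn : Fin I → ℕ} (γ : Fin I → ℝ)
    (xl xu : ∀ i : Fin I, Fin (Jn i) → Fin K → ℝ)
    (d : ∀ i : Fin I, Fin (Jn i) → ℝ) (p0 : ℝ) (p : Fin I → ℝ)
    (v : Fin I → Fin K → ℝ) (u : ∀ i : Fin I, Fin (Jn i) → Fin K → ℝ) : Prop :=
  (∀ i j, -(∑ k, u i j k) =
      γ i * d i j * Real.log (d i j / p0) + (1 - γ i) * d i j * Real.log (p i / p0)) ∧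
  (∀ i k, (∑ j, u i j k) = v i k) ∧
  (∀ i j k, xl i j k * d i j ≤ u i j k ∧ u i j k ≤ xu i j k * d i j)

/-- Under (A3), (MP3) and (MCOP3) have equal objective values when `v` aggregates `x`. -/
theorem MP3Obj_eq_MCOP3Obj {I K : ℕ} {Jn : Fin I → ℕ}
    {φ : ∀ i : Fin I, Fin (Jn i) → Fin K → ℝ} {ρ : Fin I → Fin K → ℝ} (hA3 : A3 φ ρ)
    (ψ : ∀ i : Fin I, Fin (Jn i) → ℝ) {d : ∀ i : Fin I, Fin (Jn i) → ℝ}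
    {x : ∀ i : Fin I, Fin (Jn i) → Fin K → ℝ} {v : Fin I → Fin K → ℝ}
    (hv : ∀ i k, v i k = ∑ j, x i j k * d i j) :
    MP3Obj φ ψ d x = MCOP3Obj ρ ψ d v := by
  refine Finset.sum_congr rfl fun i _ => ?_
  simp only [sub_mul, Finset.sum_sub_distrib, hv, Finset.mul_sum, Finset.sum_mul,
    (hA3 i _).2]
  rw [Finset.sum_comm]
  simp only [mul_assoc]

/-- The log-linear relation between utilities and choice probabilities determines the nested
logit probabilities. -/
theorem nested_logit_of_log_eq {I K : ℕ} {Jn : Fin I → ℕ} {γ : Fin I → ℝ}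
    (hγ : ∀ i, 0 < γ i) {d : ∀ i : Fin I, Fin (Jn i) → ℝ} {p0 : ℝ} {p : Fin I → ℝ}
    {x : ∀ i : Fin I, Fin (Jn i) → Fin K → ℝ}
    (hp : ∀ i, p i = ∑ j, d i j) (hsum : p0 + ∑ i, p i = 1)
    (hp0 : 0 < p0) (hppos : ∀ i, 0 < p i) (hd : ∀ i j, 0 < d i j)
    (hlog : ∀ i j, -(∑ k, x i j k) =
      γ i * Real.log (d i j / p0) + (1 - γ i) * Real.log (p i / p0)) (i : Fin I)
    (j : Fin (Jn i)) :
    d i j = (nestSum γ x i) ^ (γ i) / (1 + ∑ i', (nestSum γ x i') ^ (γ i')) *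
        (Real.exp (-(∑ k, x i j k) / γ i) / nestSum γ x i) := by
  set c : Fin I → ℝ := fun i =>
    Real.exp ((1 - γ i) / γ i * Real.log (p i / p0))
  have hexp : ∀ i j, Real.exp (-(∑ k, x i j k) / γ i) = d i j / p0 * c i := by
    intro i j
    have hγi := (hγ i).ne'
    have harg : -(∑ k, x i j k) / γ i =
        Real.log (d i j / p0) + (1 - γ i) / γ i * Real.log (p i / p0) := by
      rw [hlog]
      field_simp
    rw [harg, Real.exp_add, Real.exp_log (div_pos (hd i j) hp0)]
  have hS : ∀ i, nestSum γ x i = p i / p0 * c i := by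
    intro i
    simp only [nestSum, hexp, ← Finset.sum_mul, ← Finset.sum_div, hp]
  have hSγ : ∀ i, nestSum γ x i ^ γ i = p i / p0 := by
    intro i
    have hq := div_pos (hppos i) hp0
    have hγi := (hγ i).ne'
    rw [Real.rpow_def_of_pos (hS i ▸ mul_pos hq (Real.exp_pos _)), hS,
      Real.log_mul hq.ne' (Real.exp_pos _).ne', Real.log_exp]
    conv_rhs => rw [← Real.exp_log hq]
    congr 1
    field_simp
    ring
  have hD : 1 + ∑ i', nestSum γ x i' ^ γ i' = 1 / p0 := by
    simp only [hSγ, ← Finset.sum_div]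
    rw [eq_div_iff hp0.ne', add_mul, div_mul_cancel₀ _ hp0.ne', one_mul, hsum]
  rw [hD, hSγ, hexp, hS]
  have := (hppos i).ne'
  have : c i ≠ 0 := (Real.exp_pos _).ne'
  field_simp

/-- A feasible point of (MP3) induces a feasible point of (MCOP3) with the same `d`. -/
theorem MP3Feasible.exists_MCOP3Feasible {I K : ℕ} {Jn : Fin I → ℕ} (hJn : ∀ i, 0 < Jn i)
    {γ : Fin I → ℝ} (hγ : ∀ i, 0 < γ i)
    {xl xu : ∀ i : Fin I, Fin (Jn i) → Fin K → ℝ} {d : ∀ i : Fin I, Fin (Jn i) → ℝ}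
    {x : ∀ i : Fin I, Fin (Jn i) → Fin K → ℝ} (h : MP3Feasible γ xl xu d x) :
    ∃ p0 p, MCOP3Feasible γ xl xu d p0 p (fun i k => ∑ j, x i j k * d i j) := by
  obtain ⟨hd, hx⟩ := h
  set S := nestSum γ x
  set D := 1 + ∑ i', S i' ^ γ i'
  have hS : ∀ i, 0 < S i := fun i =>
    Finset.sum_pos (fun j _ => Real.exp_pos _) ⟨⟨0, hJn i⟩, Finset.mem_univ _⟩
  have hSγ : ∀ i, 0 < S i ^ γ i := fun i => Real.rpow_pos_of_pos (hS i) _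
  have hD : 0 < D := add_pos_of_pos_of_nonneg one_pos
    (Finset.sum_nonneg fun i _ => (hSγ i).le)
  have hdpos : ∀ i j, 0 < d i j := fun i j => by
    rw [hd]
    exact mul_pos (div_pos (hSγ i) hD) (div_pos (Real.exp_pos _) (hS i))
  have hppos : ∀ i, 0 < S i ^ γ i / D := fun i => div_pos (hSγ i) hD
  have hp0 : 0 < 1 / D := one_div_pos.mpr hD
  have hp : ∀ i, S i ^ γ i / D = ∑ j, d i j := by
    intro i
    have hsum : ∑ j, Real.exp (-(∑ k, x i j k) / γ i) = S i := rfl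
    simp only [hd, ← Finset.mul_sum, ← Finset.sum_div]
    rw [hsum, div_self (hS i).ne', mul_one]
  have hlog : ∀ i j, γ i * Real.log (d i j / (1 / D)) +
      (1 - γ i) * Real.log (S i ^ γ i / D / (1 / D)) = -∑ k, x i j k := by
    intro i j
    have hdq : d i j / (1 / D) = S i ^ γ i * (Real.exp (-(∑ k, x i j k) / γ i) / S i) := by
      rw [hd]
      field_simp
    have hpq : S i ^ γ i / D / (1 / D) = S i ^ γ i := by field_simp
    have hγi := (hγ i).ne'
    rw [hdq, hpq, Real.log_mul (hSγ i).ne' (div_pos (Real.exp_pos _) (hS i)).ne',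
      Real.log_div (Real.exp_pos _).ne' (hS i).ne', Real.log_exp, Real.log_rpow (hS i)]
    field_simp
    ring
  refine ⟨1 / D, fun i => S i ^ γ i / D, fun i => le_of_eq ?_, fun i j => ?_, fun i k => ?_, hp,
    ?_, hp0, hppos, hdpos⟩
  · have hrw : (1 - γ i) * (S i ^ γ i / D) * Real.log (S i ^ γ i / D / (1 / D)) =
        ∑ j, d i j * ((1 - γ i) * Real.log (S i ^ γ i / D / (1 / D))) := by
      rw [← Finset.sum_mul, ← hp]
      ring
    rw [hrw, Finset.mul_sum, ← Finset.sum_add_distrib, Finset.sum_comm,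
      ← Finset.sum_neg_distrib]
    refine Finset.sum_congr rfl fun j _ => ?_
    rw [← Finset.sum_mul, ← neg_mul, ← hlog i j]
    ring
  · have hle : ∑ k, x i j k ≤ ∑ k, xu i j k := Finset.sum_le_sum fun k _ => (hx i j k).2
    have hx' : ∑ k, x i j k = γ i * Real.log (1 / D / d i j) +
        (1 - γ i) * Real.log (1 / D / (S i ^ γ i / D)) := by
      rw [← inv_div (d i j), ← inv_div (S i ^ γ i / D), Real.log_inv, Real.log_inv]
      linarith [hlog i j]
    calc _ = 1 / D * ∑ k, x i j k := by rw [hx']; ring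
      _ ≤ _ := mul_le_mul_of_nonneg_left hle hp0.le
  · exact ⟨Finset.sum_le_sum fun j _ => mul_le_mul_of_nonneg_right (hx i j k).1 (hdpos i j).le,
      Finset.sum_le_sum fun j _ => mul_le_mul_of_nonneg_right (hx i j k).2 (hdpos i j).le⟩
  · rw [← Finset.sum_div, ← add_div]
    exact div_self hD.ne'

/-- under (A3), an optimal solution of (MCOP3) together with a
solution `u*` of (S3) transforms into an optimal solution of (MP3) via
`x*^[i]_{jk} = u*^[i]_{jk} / d*^[i]_j`. -/
theorem mcop3_optimal_to_mp3_optimal (I K : ℕ) (hI : 0 < I) (hK : 0 < K)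
    (Jn : Fin I → ℕ) (hJn : ∀ i, 0 < Jn i)
    (γ : Fin I → ℝ) (hγ : ∀ i, 0 < γ i ∧ γ i ≤ 1)
    (φ : ∀ i : Fin I, Fin (Jn i) → Fin K → ℝ) (ψ : ∀ i : Fin I, Fin (Jn i) → ℝ)
    (ρ : Fin I → Fin K → ℝ)
    (xl xu : ∀ i : Fin I, Fin (Jn i) → Fin K → ℝ)
    (hbounds : ∀ i j k, xl i j k ≤ xu i j k)
    (hA3 : A3 φ ρ)
    (d : ∀ i : Fin I, Fin (Jn i) → ℝ) (p0 : ℝ) (p : Fin I → ℝ)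
    (v : Fin I → Fin K → ℝ)
    (hopt : MCOP3Optimal ρ ψ γ xl xu d p0 p v)
    (u : ∀ i : Fin I, Fin (Jn i) → Fin K → ℝ)
    (hu : S3Sol γ xl xu d p0 p v u)
    (x : ∀ i : Fin I, Fin (Jn i) → Fin K → ℝ)
    (hx : ∀ i j k, x i j k = u i j k / d i j) :
    MP3Optimal φ ψ γ xl xu d x := by
  obtain ⟨⟨-, -, -, hp, hsum, hp0, hppos, hd⟩, hmax⟩ := hopt
  obtain ⟨hu1, hu2, hu3⟩ := hu
  have hxd : ∀ i j k, x i j k * d i j = u i j k := fun i j k => by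
    rw [hx, div_mul_cancel₀ _ (hd i j).ne']
  refine ⟨⟨nested_logit_of_log_eq (fun i => (hγ i).1) hp hsum hp0 hppos hd fun i j => ?_,
    fun i j k => ?_⟩, fun d' x' h' => ?_⟩
  · refine mul_right_cancel₀ (hd i j).ne' ?_
    rw [neg_mul, Finset.sum_mul]
    simp only [hxd]
    rw [hu1]
    ring
  · rw [hx, le_div_iff₀ (hd i j), div_le_iff₀ (hd i j)]
    exact hu3 i j k
  · obtain ⟨p0', p', hfeas⟩ := h'.exists_MCOP3Feasible hJn fun i => (hγ i).1
    rw [MP3Obj_eq_MCOP3Obj hA3 ψ (v := fun i k => ∑ j, x' i j k * d' i j) fun _ _ => rfl,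
      MP3Obj_eq_MCOP3Obj hA3 ψ (v := v) fun i k => by simp only [hxd, hu2]]
    exact hmax _ _ _ _ hfeas
end

section
/- Every feasible solution (d, p, v, e, f, g, h) to (MCP3) satisfies d^[i]_j > 0 for all (i,j) ∈ IJ and p^[i] > 0 for all i ∈ I as well as p^[0] > 0. -/
open Finset

/-- The exponential cone (closure of the hypograph-type region). -/
def Kexp : Set (ℝ × ℝ × ℝ) :=
  {a | (a.2.2 ≤ a.2.1 * Real.log (a.1 / a.2.1) ∧ 0 < a.1 ∧ 0 < a.2.1) ∨
       (a.2.1 = 0 ∧ 0 ≤ a.1 ∧ a.2.2 ≤ 0)}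

/-- Feasibility for the conic problem (MCP3). -/
def MCP3Feasible {I K : ℕ} {Jn : Fin I → ℕ} (γ : Fin I → ℝ)
    (xl xu : ∀ i : Fin I, Fin (Jn i) → Fin K → ℝ)
    (d : ∀ i : Fin I, Fin (Jn i) → ℝ) (p0 : ℝ) (p : Fin I → ℝ)
    (v : Fin I → Fin K → ℝ)
    (e f : ∀ i : Fin I, Fin (Jn i) → ℝ) (g h : Fin I → ℝ) : Prop :=
  (∀ i k, (∑ j, xl i j k * d i j) ≤ v i k ∧ v i k ≤ ∑ j, xu i j k * d i j) ∧
  (∀ i, γ i * ∑ j, e i j + (1 - γ i) * g i = ∑ k, v i k) ∧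
  (∀ i j, γ i * f i j + (1 - γ i) * h i = -(p0 * ∑ k, xu i j k)) ∧
  (∀ i, p i = ∑ j, d i j) ∧
  (p0 + ∑ i, p i = 1) ∧
  (∀ i j, (p0, d i j, e i j) ∈ Kexp) ∧
  (∀ i j, (d i j, p0, f i j) ∈ Kexp) ∧
  (∀ i, (p0, p i, g i) ∈ Kexp) ∧
  (∀ i, (p i, p0, h i) ∈ Kexp)

/-- A point of the exponential cone with positive second coordinate has positive
first coordinate. -/
lemma pos_fst_of_mem_Kexp {a b c : ℝ} (habc : (a, b, c) ∈ Kexp) (hb : 0 < b) : 0 < a :=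
  habc.elim (fun hm => hm.2.1) (fun hm => absurd hm.1 hb.ne')

/-- every feasible solution of (MCP3) has strictly positive
`d`, `p` and `p^[0]`. -/
theorem mcp3_feasible_strictly_positive (I K : ℕ) (hI : 0 < I) (hK : 0 < K)
    (Jn : Fin I → ℕ) (hJn : ∀ i, 0 < Jn i)
    (γ : Fin I → ℝ) (hγ : ∀ i, 0 < γ i ∧ γ i ≤ 1)
    (ψ : ∀ i : Fin I, Fin (Jn i) → ℝ) (ρ : Fin I → Fin K → ℝ)
    (xl xu : ∀ i : Fin I, Fin (Jn i) → Fin K → ℝ)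
    (hbounds : ∀ i j k, xl i j k ≤ xu i j k)
    (d : ∀ i : Fin I, Fin (Jn i) → ℝ) (p0 : ℝ) (p : Fin I → ℝ)
    (v : Fin I → Fin K → ℝ)
    (e f : ∀ i : Fin I, Fin (Jn i) → ℝ) (g h : Fin I → ℝ)
    (hfeas : MCP3Feasible γ xl xu d p0 p v e f g h) :
    (∀ i j, 0 < d i j) ∧ (∀ i, 0 < p i) ∧ 0 < p0 := by
  obtain ⟨-, -, -, -, hsum, -, hf, hg, hh⟩ := hfeas
  have hp0 : 0 < p0 := by
    by_contra hneg
    have hp : ∀ i, p i = 0 := fun i =>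
      (hg i).elim (fun hi => absurd hi.2.1 hneg) (fun hi => hi.1)
    simp only [hp, sum_const_zero, add_zero] at hsum
    exact hneg (hsum ▸ one_pos)
  exact ⟨fun i j => pos_fst_of_mem_Kexp (hf i j) hp0,
    fun i => pos_fst_of_mem_Kexp (hh i) hp0, hp0⟩
end

section
/- Assume the matrix I − ρ is invertible with (I − ρ)^{-1} = I + ∑_{n=1}^∞ ρ^n having nonnegative entries (equivalently, the series ∑_{n=1}^∞ ρ^n converges entrywise). If problem (MCP2) is feasible, then (MCP2) has an optimal solution, i.e., there exists a feasible solution whose objective value is ≥ the objective value of every feasible solution. -/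
open Finset

/-- Feasibility for the conic problem (MCP2). -/
def MCP2Feasible {J K : ℕ} (lam : Fin J → ℝ) (ρ : Fin J → Fin J → ℝ)
    (xl xu : Fin J → Fin K → ℝ)
    (v d : Fin J → ℝ) (u : Fin J → Fin K → ℝ) : Prop :=
  (∀ j, v j = lam j + ∑ i, ρ i j * (v i - d i)) ∧
  (∀ j, (v j, d j, ∑ k, u j k) ∈ Kexp) ∧
  (∀ j, (d j, v j, -(v j * ∑ k, xu j k)) ∈ Kexp) ∧
  (∀ j k, xl j k * d j ≤ u j k ∧ u j k ≤ xu j k * d j)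

/-- Optimality for the conic problem (MCP2). -/
def MCP2Optimal {J K : ℕ} (φ : Fin J → Fin K → ℝ) (ψ : Fin J → ℝ)
    (lam : Fin J → ℝ) (ρ : Fin J → Fin J → ℝ) (xl xu : Fin J → Fin K → ℝ)
    (v d : Fin J → ℝ) (u : Fin J → Fin K → ℝ) : Prop :=
  MCP2Feasible lam ρ xl xu v d u ∧
  ∀ v' d' u', MCP2Feasible lam ρ xl xu v' d' u' → MCOP2Obj φ ψ d' u' ≤ MCOP2Obj φ ψ d u

/-- The exponential cone as an intersection of closed half-spaces. -/
lemma mem_Kexp_iff (a : ℝ × ℝ × ℝ) :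
    a ∈ Kexp ↔ 0 ≤ a.1 ∧ 0 ≤ a.2.1 ∧
      ∀ t : ℝ, a.2.2 ≤ a.1 * Real.exp (-t) + (t - 1) * a.2.1 := by
  obtain ⟨x, y, z⟩ := a
  simp only [Kexp, Set.mem_ofPred_eq]
  constructor
  · rintro (⟨h, hx, hy⟩ | ⟨rfl, hx, hz⟩)
    · refine ⟨hx.le, hy.le, fun t => h.trans ?_⟩
      have hlog := Real.log_le_sub_one_of_pos (mul_pos (div_pos hx hy) (Real.exp_pos (-t)))
      rw [Real.log_mul (div_pos hx hy).ne' (Real.exp_pos _).ne', Real.log_exp] at hlog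
      have hmul : y * Real.log (x / y) ≤ y * (x / y * Real.exp (-t) - 1 + t) :=
        mul_le_mul_of_nonneg_left (by linarith) hy.le
      have hxy : y * (x / y * Real.exp (-t) - 1 + t) = x * Real.exp (-t) + (t - 1) * y := by
        field_simp
        ring
      linarith
    · refine ⟨hx, le_rfl, fun t => ?_⟩
      have := mul_nonneg hx (Real.exp_pos (-t)).le
      linarith
  · rintro ⟨hx, hy, h⟩
    rcases hy.eq_or_lt with rfl | hy
    · refine Or.inr ⟨rfl, hx, ?_⟩
      by_contra! hz
      rcases hx.eq_or_lt with rfl | hx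
      · have := h 0
        simp at this
        linarith
      · have := h (-Real.log (z / (2 * x)))
        rw [neg_neg, Real.exp_log (by positivity)] at this
        have hxz : x * (z / (2 * x)) = z / 2 := by field_simp
        linarith
    · rcases hx.eq_or_lt with rfl | hx
      · have := h ((z - 1) / y + 1)
        have hyz : ((z - 1) / y + 1 - 1) * y = z - 1 := by
          field_simp
          ring
        linarith
      · refine Or.inl ⟨?_, hx, hy⟩
        have := h (Real.log (x / y))
        rw [Real.exp_neg, Real.exp_log (div_pos hx hy)] at this
        have hxy : x * (x / y)⁻¹ = y := by field_simp
        linarith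

lemma isClosed_Kexp : IsClosed Kexp := by
  have h : Kexp = {a : ℝ × ℝ × ℝ | 0 ≤ a.1 ∧ 0 ≤ a.2.1 ∧
      ∀ t : ℝ, a.2.2 ≤ a.1 * Real.exp (-t) + (t - 1) * a.2.1} :=
    Set.ext mem_Kexp_iff
  rw [h]
  simp only [Set.ofPred_and, Set.ofPred_forall]
  exact (isClosed_le (by fun_prop) (by fun_prop)).inter
    ((isClosed_le (by fun_prop) (by fun_prop)).inter
      (isClosed_iInter fun t => isClosed_le (by fun_prop) (by fun_prop)))

/-- A member of the exponential cone with nonnegative last coordinate has `a.2.1 ≤ a.1`. -/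
lemma snd_le_fst_of_mem_Kexp {a : ℝ × ℝ × ℝ} (ha : a ∈ Kexp) (h : 0 ≤ a.2.2) :
    a.2.1 ≤ a.1 := by
  have := ((mem_Kexp_iff a).1 ha).2.2 0
  simp at this
  linarith

lemma isClosed_setOf_MCP2Feasible {J K : ℕ} (lam : Fin J → ℝ) (ρ : Fin J → Fin J → ℝ)
    (xl xu : Fin J → Fin K → ℝ) :
    IsClosed {p : (Fin J → ℝ) × (Fin J → ℝ) × (Fin J → Fin K → ℝ) |
      MCP2Feasible lam ρ xl xu p.1 p.2.1 p.2.2} := by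
  unfold MCP2Feasible
  simp only [Set.ofPred_and, Set.ofPred_forall]
  refine IsClosed.inter ?_ (IsClosed.inter ?_ (IsClosed.inter ?_ ?_))
  · exact isClosed_iInter fun j => isClosed_eq (by fun_prop) (by fun_prop)
  · exact isClosed_iInter fun j => isClosed_Kexp.preimage (by fun_prop)
  · exact isClosed_iInter fun j => isClosed_Kexp.preimage (by fun_prop)
  · exact isClosed_iInter fun j => isClosed_iInter fun k =>
      (isClosed_le (by fun_prop) (by fun_prop)).inter
        (isClosed_le (by fun_prop) (by fun_prop))

lemma MCP2Feasible.nonneg_and_le {J K : ℕ} {lam : Fin J → ℝ} {ρ : Fin J → Fin J → ℝ}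
    {xl xu : Fin J → Fin K → ℝ} {v d : Fin J → ℝ} {u : Fin J → Fin K → ℝ}
    (h : MCP2Feasible lam ρ xl xu v d u) (hxl : ∀ j k, 0 ≤ xl j k) (j : Fin J) :
    0 ≤ d j ∧ d j ≤ v j := by
  have hd : 0 ≤ d j := ((mem_Kexp_iff _).1 (h.2.1 j)).2.1
  have hu : 0 ≤ ∑ k, u j k :=
    sum_nonneg fun k _ => (mul_nonneg (hxl j k) hd).trans (h.2.2.2 j k).1
  exact ⟨hd, snd_le_fst_of_mem_Kexp (h.2.1 j) hu⟩

/-- If `1 - ρ` has a nonnegative inverse, then `v ≤ c + v ρ` bounds `v` by `c (1 - ρ)⁻¹`. -/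
lemma le_vecMul_inv_one_sub {n : Type*} [Fintype n] [DecidableEq n] {ρ : Matrix n n ℝ}
    (hunit : IsUnit (1 - ρ)) (hnonneg : ∀ i j, 0 ≤ (1 - ρ)⁻¹ i j) {c v : n → ℝ}
    (h : v ≤ c + Matrix.vecMul v ρ) : v ≤ Matrix.vecMul c (1 - ρ)⁻¹ := by
  have hdet : IsUnit (1 - ρ).det := (Matrix.isUnit_iff_isUnit_det _).1 hunit
  have hv : v = Matrix.vecMul (Matrix.vecMul v (1 - ρ)) (1 - ρ)⁻¹ := by
    rw [Matrix.vecMul_vecMul, Matrix.mul_nonsing_inv _ hdet, Matrix.vecMul_one]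
  intro j
  rw [hv]
  refine sum_le_sum fun i _ => mul_le_mul_of_nonneg_right ?_ (hnonneg i j)
  have := h i
  simp only [Matrix.vecMul_sub, Matrix.vecMul_one, Pi.sub_apply, Pi.add_apply] at this ⊢
  linarith

/-- if `I − ρ` is invertible, with inverse `I + ∑_{n≥1} ρ^n` (the series
converging entrywise) having nonnegative entries, and (MCP2) is feasible, then (MCP2)
has an optimal solution. -/
theorem mcp2_feasible_implies_solvable (J K : ℕ) (hJ : 0 < J) (hK : 0 < K)
    (φ : Fin J → Fin K → ℝ) (hφ : ∀ j k, 0 < φ j k) (ψ : Fin J → ℝ)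
    (lam : Fin J → ℝ) (hlam : ∀ j, 0 ≤ lam j)
    (ρ : Matrix (Fin J) (Fin J) ℝ) (hρ : ∀ i j, 0 ≤ ρ i j)
    (xl xu : Fin J → Fin K → ℝ) (hxl : ∀ j k, 0 ≤ xl j k)
    (hbounds : ∀ j k, xl j k ≤ xu j k)
    (hsummable : ∀ i j, Summable (fun n : ℕ => (ρ ^ (n + 1)) i j))
    (hunit : IsUnit (1 - ρ))
    (hinv : (1 - ρ)⁻¹ = 1 + Matrix.of (fun i j => ∑' n : ℕ, (ρ ^ (n + 1)) i j))
    (hnonneg : ∀ i j, 0 ≤ (1 - ρ)⁻¹ i j)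
    (hfeas : ∃ v d u, MCP2Feasible lam (fun i j => ρ i j) xl xu v d u) :
    ∃ v d u, MCP2Optimal φ ψ lam (fun i j => ρ i j) xl xu v d u := by
  obtain ⟨v₀, d₀, u₀, h₀⟩ := hfeas
  set S : Set ((Fin J → ℝ) × (Fin J → ℝ) × (Fin J → Fin K → ℝ)) :=
    {p | MCP2Feasible lam (fun i j => ρ i j) xl xu p.1 p.2.1 p.2.2} with hS
  set w : Fin J → ℝ := Matrix.vecMul lam (1 - ρ)⁻¹
  have hsub : S ⊆ Set.Icc (0, 0, 0) (w, w, fun j k => xu j k * w j) := by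
    rintro ⟨v, d, u⟩ (h : MCP2Feasible lam (fun i j => ρ i j) xl xu v d u)
    have hdv := h.nonneg_and_le hxl
    have hvw : v ≤ w := by
      refine le_vecMul_inv_one_sub hunit hnonneg fun j => ?_
      rw [h.1 j]
      refine add_le_add_right (sum_le_sum fun i _ => ?_) _
      rw [mul_comm]
      exact mul_le_mul_of_nonneg_right (by linarith [(hdv i).1]) (hρ i j)
    refine ⟨⟨fun j => (hdv j).1.trans (hdv j).2, fun j => (hdv j).1, fun j k => ?_⟩,
      ⟨hvw, fun j => (hdv j).2.trans (hvw j), fun j k => ?_⟩⟩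
    · exact (mul_nonneg (hxl j k) (hdv j).1).trans (h.2.2.2 j k).1
    · exact (h.2.2.2 j k).2.trans <| mul_le_mul_of_nonneg_left
        ((hdv j).2.trans (hvw j)) ((hxl j k).trans (hbounds j k))
  have hcompact : IsCompact S :=
    isCompact_Icc.of_isClosed_subset (isClosed_setOf_MCP2Feasible _ _ _ _) hsub
  have hcont : Continuous fun p : (Fin J → ℝ) × (Fin J → ℝ) × (Fin J → Fin K → ℝ) =>
      MCOP2Obj φ ψ p.2.1 p.2.2 := by
    unfold MCOP2Obj
    fun_prop
  obtain ⟨⟨v, d, u⟩, hmem, hmax⟩ :=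
    hcompact.exists_isMaxOn ⟨(v₀, d₀, u₀), h₀⟩ hcont.continuousOn
  exact ⟨v, d, u, hmem, fun v' d' u' h' => hmax (show (v', d', u') ∈ S from h')⟩
end
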